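/- Define the coding coefficients c_{r,s} of a cobweb poset by c_{r,r} = 1, c_{r,r+1} = -1, and c_{r,s} = -(c_{r,r} + ∑_{i=r+1}^{s-1} F_i · c_{r,i}) for s > r+1. Then c_{r,s} = (-1)^{s-r} ∏_{i=r+1}^{s-1}(F_i - 1) for all s > r. -/

import Mathlib

/-- The coding coefficients of the Möbius matrix of a cobweb poset:
if `c r r = 1`, `c r (r+1) = -1` and
`c r s = -(1 + ∑_{i=r+1}^{s-1} F i * c r i)` for `s > r + 1`, then
`c r s = (-1)^(s-r) ∏_{i=r+1}^{s-1} (F i - 1)` for all `s > r`. -/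
theorem cobweb_coding_coefficients (F : ℕ → ℕ) (hF : ∀ i, 0 < F i)
    (c : ℕ → ℕ → ℤ)
    (hdiag : ∀ r, c r r = 1)
    (hsucc : ∀ r, c r (r + 1) = -1)
    (hrec : ∀ r s, r + 1 < s →
      c r s = -(1 + ∑ i ∈ Finset.Ico (r + 1) s, (F i : ℤ) * c r i))
    (r s : ℕ) (hrs : r < s) :
    c r s = (-1 : ℤ) ^ (s - r) * ∏ i ∈ Finset.Ico (r + 1) s, ((F i : ℤ) - 1) := by
  have hrec' : ∀ s, r + 1 ≤ s →
      c r s = -(1 + ∑ i ∈ Finset.Ico (r + 1) s, (F i : ℤ) * c r i) := by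
    intro s hs
    rcases hs.eq_or_lt with h | h
    · subst h
      simp [hsucc]
    · exact hrec r s h
  induction s, (show r + 1 ≤ s from hrs) using Nat.le_induction with
  | base => simp [hsucc]
  | succ n hn ih =>
    have ih' := ih hn
    have h1 := hrec' n hn
    have h2 := hrec' (n + 1) (by omega)
    rw [Finset.sum_Ico_succ_top hn] at h2
    have h3 : c r (n + 1) = -((F n : ℤ) - 1) * c r n := by linarith
    rw [h3, ih', Finset.prod_Ico_succ_top hn, show n + 1 - r = (n - r) + 1 by omega, pow_succ]
    ring
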